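/- For every i = 1,…,n, the linear map Bᵢ is a derivation of the Lie algebra 𝔫 (equivalently, the 1-cochain bᵢ = e_{γᵢ} ⊗ f^{αᵢ} is a Chevalley–Eilenberg cocycle in C¹(𝔫;𝔫)). -/

import Mathlib

open scoped InnerProductSpace

attribute [local instance 100] LieRing.ofAssociativeRing

/-- The combinatorial data attached to a simple finite-dimensional complex Lie algebra `𝔤`
of rank `n` with a fixed Cartan subalgebra and a fixed system of simple roots
`α₁, …, αₙ`: a reduced crystallographic *irreducible* root system `R` in a euclidean
space `V`, together with a base `simple : Fin n → V` (the simple roots) and the coordinate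
functions `coord`, recording for each positive root `α = Σᵢ Aᵢ(α) αᵢ` the tuple
`(A₁(α), …, Aₙ(α))` of its coordinates with respect to the simple roots. -/
structure RootSystemBase (n : ℕ) (V : Type*) [NormedAddCommGroup V]
    [InnerProductSpace ℝ V] : Type _ where
  /-- The (finite) set of roots. -/
  R : Finset V
  zero_not_mem : (0 : V) ∉ R
  span_eq_top : Submodule.span ℝ (R : Set V) = ⊤
  reduced : ∀ α ∈ R, ∀ c : ℝ, c • α ∈ R → c = 1 ∨ c = -1
  crystallographic : ∀ α ∈ R, ∀ β ∈ R, ∃ k : ℤ, (k : ℝ) = 2 * ⟪β, α⟫_ℝ / ⟪α, α⟫_ℝ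
  reflect_mem : ∀ α ∈ R, ∀ β ∈ R, β - (2 * ⟪β, α⟫_ℝ / ⟪α, α⟫_ℝ) • α ∈ R
  /-- irreducibility: `R` is not the union of two nonempty orthogonal subsets;
  equivalently `𝔤` is simple rather than merely semisimple. -/
  irreducible : ∀ S : Finset V, S ⊆ R → (∀ α ∈ S, ∀ β ∈ R, β ∉ S → ⟪α, β⟫_ℝ = 0) →
    S = ∅ ∨ S = R
  /-- The simple roots `α₁, …, αₙ`. -/
  simple : Fin n → V
  simple_mem : ∀ i, simple i ∈ R
  simple_linearIndependent : LinearIndependent ℝ simple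
  /-- `coord β i` is the coefficient `Aᵢ(β)` of `β` in the basis of simple roots. -/
  coord : V → Fin n → ℤ
  root_eq_sum : ∀ β ∈ R, β = ∑ i, (coord β i : ℝ) • simple i
  coord_sign : ∀ β ∈ R, (∀ i, 0 ≤ coord β i) ∨ (∀ i, coord β i ≤ 0)

namespace RootSystemBase

variable {n : ℕ} {V : Type*} [NormedAddCommGroup V] [InnerProductSpace ℝ V]
variable (Φ : RootSystemBase n V)

/-- `β` is a positive root. -/
def IsPos (β : V) : Prop := β ∈ Φ.R ∧ ∀ i, 0 ≤ Φ.coord β i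

/-- The level `l(β) = Σᵢ Aᵢ(β)` of a root `β`. -/
def level (β : V) : ℤ := ∑ i, Φ.coord β i

/-- `μ` is the highest root. -/
def IsHighest (μ : V) : Prop :=
  Φ.IsPos μ ∧ ∀ β, Φ.IsPos β → ∀ i, Φ.coord β i ≤ Φ.coord μ i

end RootSystemBase

/-- A linear map `T : 𝔫 → 𝔫` is a derivation of the Lie algebra `𝔫`. -/
def IsLieDerivation {L : Type*} [LieRing L] [LieAlgebra ℂ L] (T : Module.End ℂ L) : Prop :=
  ∀ x y : L, T ⁅x, y⁆ = ⁅T x, y⁆ + ⁅x, T y⁆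

/-- The inner derivations `ad x`, `x ∈ 𝔫`, as a subspace of `End(𝔫)`. -/
noncomputable def innerDerivations (L : Type*) [LieRing L] [LieAlgebra ℂ L] :
    Submodule ℂ (Module.End ℂ L) :=
  LinearMap.range (LieAlgebra.ad ℂ L).toLinearMap

/-- The derivations of `𝔫`, as a subspace of `End(𝔫)`. -/
noncomputable def derivations (L : Type*) [LieRing L] [LieAlgebra ℂ L] :
    Submodule ℂ (Module.End ℂ L) where
  carrier := {T | IsLieDerivation T}
  add_mem' := by
    intro S T hS hT x y
    simp only [LinearMap.add_apply, hS x y, hT x y, add_lie, lie_add]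
    abel
  zero_mem' := by intro x y; simp
  smul_mem' := by
    intro c T hT x y
    simp only [LinearMap.smul_apply, hT x y, smul_lie, lie_smul, smul_add]

/-- A Chevalley-basis presentation of the maximal nilpotent subalgebra
`𝔫 = ⊕_{α ∈ R⁺} 𝔤_α` of a simple finite-dimensional complex Lie algebra `𝔤` with root
system `Φ`: a complex Lie algebra `𝔫` together with a basis `e` of root vectors indexed
by the positive roots, such that `⁅e_α, e_β⁆ = N_{αβ} • e_{α+β}` when `α+β ∈ R⁺` and
`⁅e_α, e_β⁆ = 0` otherwise, where the structure constants `N_{αβ}` of the Chevalley basis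
are nonzero whenever `α + β` is a root. -/
structure ChevalleyNilradical {n : ℕ} {V : Type*} [NormedAddCommGroup V]
    [InnerProductSpace ℝ V] (Φ : RootSystemBase n V)
    (L : Type*) [LieRing L] [LieAlgebra ℂ L] where
  /-- the root vectors `e_α`, `α ∈ R⁺`, a basis of `𝔫` -/
  e : Module.Basis {β : V // Φ.IsPos β} ℂ L
  /-- the structure constants -/
  N : V → V → ℂ
  lie_eq : ∀ (α β : {β : V // Φ.IsPos β}) (h : Φ.IsPos (α.1 + β.1)),
    ⁅e α, e β⁆ = N α.1 β.1 • e ⟨α.1 + β.1, h⟩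
  lie_eq_zero : ∀ α β : {β : V // Φ.IsPos β}, ¬ Φ.IsPos (α.1 + β.1) → ⁅e α, e β⁆ = 0
  N_ne_zero : ∀ α β : {β : V // Φ.IsPos β}, Φ.IsPos (α.1 + β.1) → N α.1 β.1 ≠ 0

namespace ChevalleyNilradical

variable {n : ℕ} {V : Type*} [NormedAddCommGroup V] [InnerProductSpace ℝ V]
  {Φ : RootSystemBase n V} {L : Type*} [LieRing L] [LieAlgebra ℂ L]
  (C : ChevalleyNilradical Φ L)

/-- The weight-zero cocycle (derivation) `Dᵢ = cᵢ : e_α ↦ Aᵢ(α) e_α`. -/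
noncomputable def D (i : Fin n) : Module.End ℂ L :=
  C.e.constr ℂ fun β => (Φ.coord β.1 i : ℂ) • C.e β

/-- The cocycle (derivation) `Bᵢ = bᵢ = e_{γᵢ} ⊗ f^{αᵢ}`, sending `e_{αᵢ} ↦ e_{γᵢ}` where
`γᵢ = μ − mᵢ αᵢ`, and killing `e_β` for every positive root `β ≠ αᵢ`. -/
noncomputable def B (μ : V) (m : Fin n → ℕ)
    (hγ : ∀ i, Φ.IsPos (μ - m i • Φ.simple i)) (i : Fin n) : Module.End ℂ L :=
  letI := Classical.decEq V
  C.e.constr ℂ fun β => if β.1 = Φ.simple i then C.e ⟨μ - m i • Φ.simple i, hγ i⟩ else 0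

end ChevalleyNilradical

namespace RootSystemBase

variable {n : ℕ} {V : Type*} [NormedAddCommGroup V] [InnerProductSpace ℝ V]
  (Φ : RootSystemBase n V)

/-- The coordinates of a root are determined by any expansion in the simple roots. -/
theorem coord_eq_of_eq_sum {β : V} (hβ : β ∈ Φ.R) {c : Fin n → ℤ}
    (h : β = ∑ j, (c j : ℝ) • Φ.simple j) (j : Fin n) : Φ.coord β j = c j := by
  have hsum := (Φ.root_eq_sum β hβ).symm.trans h
  have := Fintype.linearIndependent_iff.mp Φ.simple_linearIndependent
    (fun k => (Φ.coord β k : ℝ) - c k) (by simp [sub_smul, hsum]) j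
  exact_mod_cast sub_eq_zero.mp this

theorem coord_simple (i j : Fin n) : Φ.coord (Φ.simple i) j = if j = i then 1 else 0 :=
  Φ.coord_eq_of_eq_sum (c := fun j => if j = i then 1 else 0) (Φ.simple_mem i) (by simp) j

theorem coord_add {α β : V} (hα : α ∈ Φ.R) (hβ : β ∈ Φ.R) (h : α + β ∈ Φ.R) (j : Fin n) :
    Φ.coord (α + β) j = Φ.coord α j + Φ.coord β j := by
  refine Φ.coord_eq_of_eq_sum (c := fun j => Φ.coord α j + Φ.coord β j) h ?_ j
  conv_lhs => rw [Φ.root_eq_sum α hα, Φ.root_eq_sum β hβ]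
  simp [add_smul, Finset.sum_add_distrib]

theorem coord_sub_nsmul_simple {α : V} (hα : α ∈ Φ.R) (k : ℕ) (i : Fin n)
    (h : α - k • Φ.simple i ∈ Φ.R) (j : Fin n) :
    Φ.coord (α - k • Φ.simple i) j = Φ.coord α j - if j = i then (k : ℤ) else 0 := by
  refine Φ.coord_eq_of_eq_sum (c := fun j => Φ.coord α j - if j = i then (k : ℤ) else 0) h ?_ j
  conv_lhs => rw [Φ.root_eq_sum α hα]
  simp [sub_smul, Finset.sum_sub_distrib, Nat.cast_smul_eq_nsmul]

/-- A positive root supported on a single simple root is that simple root. -/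
theorem IsPos.eq_simple {β : V} (hβ : Φ.IsPos β) (i : Fin n)
    (h : ∀ j, j ≠ i → Φ.coord β j = 0) : β = Φ.simple i := by
  have hsmul : β = (Φ.coord β i : ℝ) • Φ.simple i := by
    conv_lhs => rw [Φ.root_eq_sum β hβ.1]
    exact Finset.sum_eq_single i (fun j _ hj => by simp [h j hj]) (by simp)
  have hnonneg : (0 : ℝ) ≤ Φ.coord β i := by exact_mod_cast hβ.2 i
  rcases Φ.reduced _ (Φ.simple_mem i) _ (hsmul ▸ hβ.1) with h1 | h1
  · rw [hsmul, h1, one_smul]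
  · linarith

/-- A simple root is not a sum of two positive roots. -/
theorem IsPos.add_ne_simple {α β : V} (hα : Φ.IsPos α) (hβ : Φ.IsPos β) (i : Fin n) :
    α + β ≠ Φ.simple i := by
  intro h
  have hmem : α + β ∈ Φ.R := h ▸ Φ.simple_mem i
  have hcoord (j : Fin n) : Φ.coord α j + Φ.coord β j = if j = i then 1 else 0 := by
    rw [← Φ.coord_add hα.1 hβ.1 hmem, h, Φ.coord_simple]
  have hα' := IsPos.eq_simple Φ hα i fun j hj => by
    have := hcoord j
    rw [if_neg hj] at this
    linarith [hα.2 j, hβ.2 j]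
  rw [hα', add_eq_left] at h
  exact Φ.zero_not_mem (h ▸ hβ.1)

/-- If `μ` is the highest root, the only positive root that can be added to `μ - k αᵢ` is `αᵢ`. -/
theorem IsHighest.not_isPos_sub_nsmul_add {μ β : V} (hμ : Φ.IsHighest μ) {k : ℕ} {i : Fin n}
    (hγ : Φ.IsPos (μ - k • Φ.simple i)) (hβ : Φ.IsPos β) (hne : β ≠ Φ.simple i) :
    ¬ Φ.IsPos (μ - k • Φ.simple i + β) := by
  refine fun h => hne (IsPos.eq_simple Φ hβ i fun j hj => ?_)
  have hle := hμ.2 _ h j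
  rw [Φ.coord_add hγ.1 hβ.1 h.1, Φ.coord_sub_nsmul_simple hμ.1.1 k i hγ.1, if_neg hj] at hle
  linarith [hβ.2 j]

end RootSystemBase

/-- The Leibniz rule may be checked on a basis. -/
theorem IsLieDerivation.of_basis {ι L : Type*} [LieRing L] [LieAlgebra ℂ L]
    (b : Module.Basis ι ℂ L) (T : Module.End ℂ L)
    (h : ∀ i j, T ⁅b i, b j⁆ = ⁅T (b i), b j⁆ + ⁅b i, T (b j)⁆) : IsLieDerivation T := by
  let bracket : L →ₗ[ℂ] L →ₗ[ℂ] L := (LieAlgebra.ad ℂ L).toLinearMap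
  have heq : bracket.compr₂ T = bracket ∘ₗ T + bracket.compl₂ T :=
    LinearMap.ext_basis b b fun i j => h i j
  exact fun x y => LinearMap.congr_fun₂ heq x y

namespace ChevalleyNilradical

variable {n : ℕ} {V : Type*} [NormedAddCommGroup V] [InnerProductSpace ℝ V]
  {Φ : RootSystemBase n V} {L : Type*} [LieRing L] [LieAlgebra ℂ L]
  (C : ChevalleyNilradical Φ L) {μ : V} {m : Fin n → ℕ}
  (hγ : ∀ i, Φ.IsPos (μ - m i • Φ.simple i)) {i : Fin n}

theorem B_e_of_eq {β : {β : V // Φ.IsPos β}} (h : β.1 = Φ.simple i) :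
    C.B μ m hγ i (C.e β) = C.e ⟨μ - m i • Φ.simple i, hγ i⟩ := by
  simp [B, h]

theorem B_e_of_ne {β : {β : V // Φ.IsPos β}} (h : β.1 ≠ Φ.simple i) :
    C.B μ m hγ i (C.e β) = 0 := by
  simp [B, h]

theorem B_lie_e (α β : {β : V // Φ.IsPos β}) : C.B μ m hγ i ⁅C.e α, C.e β⁆ = 0 := by
  by_cases h : Φ.IsPos (α.1 + β.1)
  · rw [C.lie_eq α β h, map_smul,
      C.B_e_of_ne hγ (RootSystemBase.IsPos.add_ne_simple Φ α.2 β.2 i), smul_zero]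
  · rw [C.lie_eq_zero α β h, map_zero]

end ChevalleyNilradical

/-- For every `i = 1, …, n`, the linear map `Bᵢ` is a derivation of the
Lie algebra `𝔫` (equivalently, the 1-cochain `bᵢ = e_{γᵢ} ⊗ f^{αᵢ}` is a
Chevalley–Eilenberg cocycle in `C¹(𝔫;𝔫)`). -/
theorem B_isDerivation
    {n : ℕ} {V : Type*} [NormedAddCommGroup V] [InnerProductSpace ℝ V]
    (Φ : RootSystemBase n V) (L : Type*) [LieRing L] [LieAlgebra ℂ L]
    (C : ChevalleyNilradical Φ L) (μ : V) (hμ : Φ.IsHighest μ) (m : Fin n → ℕ)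
    (hm : ∀ i, (∀ k : ℕ, k ≤ m i → Φ.IsPos (μ - k • Φ.simple i)) ∧
      ¬ Φ.IsPos (μ - (m i + 1) • Φ.simple i))
    (hγ : ∀ i, Φ.IsPos (μ - m i • Φ.simple i)) :
    ∀ i : Fin n, IsLieDerivation (C.B μ m hγ i) := by
  intro i
  have lie_γ (β : {β : V // Φ.IsPos β}) (hβ : β.1 ≠ Φ.simple i) :
      ⁅C.e ⟨μ - m i • Φ.simple i, hγ i⟩, C.e β⁆ = 0 :=
    C.lie_eq_zero _ _ (RootSystemBase.IsHighest.not_isPos_sub_nsmul_add Φ hμ (hγ i) β.2 hβ)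
  refine IsLieDerivation.of_basis C.e _ fun α β => ?_
  rw [C.B_lie_e hγ]
  by_cases hα : α.1 = Φ.simple i <;> by_cases hβ : β.1 = Φ.simple i
  · obtain rfl : α = β := Subtype.ext (hα.trans hβ.symm)
    rw [C.B_e_of_eq hγ hα, ← lie_skew, neg_add_cancel]
  · rw [C.B_e_of_eq hγ hα, C.B_e_of_ne hγ hβ, lie_γ β hβ, lie_zero, add_zero]
  · rw [C.B_e_of_ne hγ hα, C.B_e_of_eq hγ hβ, ← lie_skew (C.e α), lie_γ α hα, zero_lie,
      neg_zero, add_zero]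
  · rw [C.B_e_of_ne hγ hα, C.B_e_of_ne hγ hβ, zero_lie, lie_zero, add_zero]
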